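/- Every subgraph of a chain of parallel paths, every subdivision of a chain of parallel paths, and the transpose of a chain of parallel paths is again (when restricted to the union of paths between any two designated vertices) a chain of parallel paths; in particular, the class of graphs using only chains of parallel paths is closed under taking subgraphs. -/

import Mathlib

/-- A directed multigraph. -/
structure MultiDigraph where
  V : Type
  E : Type
  src : E → V
  tgt : E → V

namespace MultiDigraph

variable (G : MultiDigraph)

/-- `IsWalkFrom G u v es`: the edge list `es` is a directed walk from `u` to `v`. -/
def IsWalkFrom : G.V → G.V → List G.E → Prop
  | u, v, [] => u = v
  | u, v, e :: es => G.src e = u ∧ IsWalkFrom (G.tgt e) v es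

/-- The vertices visited by a walk starting at `u`. -/
def pathVerts (u : G.V) (es : List G.E) : List G.V := u :: es.map G.tgt

/-- `IsPathFrom G u v es`: `es` is a (simple) directed path from `u` to `v`. -/
def IsPathFrom (u v : G.V) (es : List G.E) : Prop :=
  G.IsWalkFrom u v es ∧ (G.pathVerts u es).Nodup

/-- The internal vertices of a path (all visited vertices except the endpoints). -/
def internals (es : List G.E) : List G.V := (es.map G.tgt).dropLast

/-- The subgraph spanned by a set of edges (on the same vertex set). -/
def edgeSubgraph (S : Set G.E) : MultiDigraph where
  V := G.V
  E := {e // e ∈ S}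
  src e := G.src e.val
  tgt e := G.tgt e.val

/-- The transpose (reverse) of a directed multigraph. -/
def transpose : MultiDigraph := ⟨G.V, G.E, G.tgt, G.src⟩

/-- The set of edges lying on some (simple) directed `u`–`v` path. -/
def pathEdges (u v : G.V) : Set G.E := {e | ∃ es, G.IsPathFrom u v es ∧ e ∈ es}

/-- The union of all directed `u`–`v` paths, as a multidigraph whose vertices are
`u`, `v` and the endpoints of edges lying on some `u`–`v` path. -/
def pathUnion (u v : G.V) : MultiDigraph where
  V := {x // x = u ∨ x = v ∨ ∃ e ∈ G.pathEdges u v, G.src e = x ∨ G.tgt e = x}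
  E := {e // e ∈ G.pathEdges u v}
  src e := ⟨G.src e.val, Or.inr (Or.inr ⟨e.val, e.property, Or.inl rfl⟩)⟩
  tgt e := ⟨G.tgt e.val, Or.inr (Or.inr ⟨e.val, e.property, Or.inr rfl⟩)⟩

/-- `u` is a vertex of `pathUnion G u v`. -/
theorem mem_pathUnion_left (u v : G.V) :
    (u = u ∨ u = v ∨ ∃ e ∈ G.pathEdges u v, G.src e = u ∨ G.tgt e = u) := Or.inl rfl

theorem mem_pathUnion_right (u v : G.V) :
    (v = u ∨ v = v ∨ ∃ e ∈ G.pathEdges u v, G.src e = v ∨ G.tgt e = v) := Or.inr (Or.inl rfl)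

/-- A chain of parallel links from `s` to `t`: vertices `v₀ = s, …, v_m = t` in a line,
every edge goes from some `v_i` to `v_{i+1}`, and every consecutive pair is joined by
at least one edge. -/
def IsChainOfParallelLinks (s t : G.V) : Prop :=
  ∃ (m : ℕ) (v : ℕ → G.V), 0 < m ∧ v 0 = s ∧ v m = t ∧
    (∀ i j, i ≤ m → j ≤ m → v i = v j → i = j) ∧
    (∀ x : G.V, ∃ i, i ≤ m ∧ v i = x) ∧
    (∀ e : G.E, ∃ i, i < m ∧ G.src e = v i ∧ G.tgt e = v (i + 1)) ∧
    (∀ i, i < m → ∃ e : G.E, G.src e = v i ∧ G.tgt e = v (i + 1))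

end MultiDigraph

open MultiDigraph

/-- `IsSubdivisionWith G H φ`: `G` is a subdivision of `H`, where `φ` embeds the
branch vertices of `H` into `G` and each `H`-edge corresponds to a nontrivial path
in `G`; the paths are internally disjoint, edge-disjoint, their internal vertices
avoid branch vertices, and together they exhaust all vertices and edges of `G`. -/
def IsSubdivisionWith (G H : MultiDigraph) (φ : H.V → G.V) : Prop :=
  ∃ P : H.E → List G.E,
    Function.Injective φ ∧
    (∀ e, G.IsPathFrom (φ (H.src e)) (φ (H.tgt e)) (P e) ∧ P e ≠ []) ∧
    (∀ e, ∀ x ∈ G.internals (P e), x ∉ Set.range φ) ∧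
    (∀ e f, e ≠ f → ∀ x ∈ G.internals (P e), x ∉ G.internals (P f)) ∧
    (∀ e f, e ≠ f → ∀ a ∈ P e, a ∉ P f) ∧
    (∀ a : G.E, ∃ e, a ∈ P e) ∧
    (∀ x : G.V, x ∈ Set.range φ ∨ ∃ e, x ∈ G.internals (P e))

/-- `H` is a topological minor of `G`: branch vertices of `H` embed injectively into
`G` and the edges of `H` are realized by internally disjoint, edge-disjoint paths
of `G` avoiding branch vertices internally. -/
def IsTopMinorOf (H G : MultiDigraph) : Prop :=
  ∃ (φ : H.V → G.V) (P : H.E → List G.E),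
    Function.Injective φ ∧
    (∀ e, G.IsPathFrom (φ (H.src e)) (φ (H.tgt e)) (P e) ∧ P e ≠ []) ∧
    (∀ e, ∀ x ∈ G.internals (P e), x ∉ Set.range φ) ∧
    (∀ e f, e ≠ f → ∀ x ∈ G.internals (P e), x ∉ G.internals (P f)) ∧
    (∀ e f, e ≠ f → ∀ a ∈ P e, a ∉ P f)

/-- A chain of parallel paths from `s` to `t`: a subdivision of a chain of
parallel links, with `s` and `t` the images of the endpoints. -/
def IsChainOfParallelPaths (G : MultiDigraph) (s t : G.V) : Prop :=
  ∃ (H : MultiDigraph) (s' t' : H.V) (φ : H.V → G.V),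
    H.IsChainOfParallelLinks s' t' ∧ IsSubdivisionWith G H φ ∧ φ s' = s ∧ φ t' = t

/-- `G` uses only chains of parallel paths: for every ordered pair `(u, v)`,
either there is no (nontrivial) `u`–`v` path, or the union of all `u`–`v` paths
is a chain of parallel paths from `u` to `v`. -/
def UsesOnlyChains (G : MultiDigraph) : Prop :=
  ∀ u v : G.V,
    (¬ ∃ es, G.IsPathFrom u v es ∧ es ≠ []) ∨
    IsChainOfParallelPaths (G.pathUnion u v)
      ⟨u, G.mem_pathUnion_left u v⟩ ⟨v, G.mem_pathUnion_right u v⟩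

namespace MultiDigraph

section Walks

variable {G : MultiDigraph}

theorem IsWalkFrom.append {y z : G.V} {q : List G.E} (hq : G.IsWalkFrom y z q) :
    ∀ {p : List G.E} {x : G.V}, G.IsWalkFrom x y p → G.IsWalkFrom x z (p ++ q)
  | [], _, hp => by
    cases hp
    exact hq
  | _ :: _, _, hp => ⟨hp.1, hq.append hp.2⟩

theorem IsWalkFrom.of_append {z : G.V} {a : G.E} {q : List G.E} :
    ∀ {p : List G.E} {x : G.V}, G.IsWalkFrom x z (p ++ a :: q) →
      G.IsWalkFrom x (G.src a) p ∧ G.IsWalkFrom (G.tgt a) z q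
  | [], _, h => ⟨h.1.symm, h.2⟩
  | _ :: _, _, h => ⟨⟨h.1, h.2.of_append.1⟩, h.2.of_append.2⟩

theorem IsWalkFrom.snoc {x : G.V} {p : List G.E} {a : G.E} (hp : G.IsWalkFrom x (G.src a) p) :
    G.IsWalkFrom x (G.tgt a) (p ++ [a]) :=
  IsWalkFrom.append (q := [a]) (y := G.src a) ⟨rfl, rfl⟩ hp

theorem IsWalkFrom.endpoints_unique {es : List G.E} (h_ne : es ≠ []) :
    ∀ {u v u' v' : G.V}, G.IsWalkFrom u v es → G.IsWalkFrom u' v' es → u = u' ∧ v = v' := by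
  induction es with
  | nil => exact absurd rfl h_ne
  | cons a q ih =>
    intro u v u' v' h h'
    refine ⟨h.1.symm.trans h'.1, ?_⟩
    rcases eq_or_ne q [] with rfl | hq
    · exact (show G.tgt a = v from h.2).symm.trans h'.2
    · exact (ih hq h.2 h'.2).2

theorem IsWalkFrom.target_mem {es : List G.E} (h_ne : es ≠ []) :
    ∀ {u v : G.V}, G.IsWalkFrom u v es → v ∈ es.map G.tgt := by
  induction es with
  | nil => exact absurd rfl h_ne
  | cons a q ih =>
    intro u v h
    rcases eq_or_ne q [] with rfl | hq
    · simp [show G.tgt a = v from h.2]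
    · exact List.mem_cons_of_mem _ (ih hq h.2)

theorem IsPathFrom.ne {u v : G.V} {es : List G.E} (h : G.IsPathFrom u v es) (h_ne : es ≠ []) :
    u ≠ v := by
  rintro rfl
  exact (List.nodup_cons.1 h.2).1 (h.1.target_mem h_ne)

theorem IsWalkFrom.dropLast_vertices :
    ∀ {q : List G.E} {x v : G.V}, G.IsWalkFrom x v q →
      (x :: q.map G.tgt).dropLast = q.map G.src
  | [], _, _, _ => rfl
  | a :: q, x, v, h => by
    have ih := h.2.dropLast_vertices
    simp only [List.map_cons, List.dropLast_cons_cons] at ih ⊢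
    rw [ih, h.1]

theorem IsWalkFrom.internals_append {p q : List G.E} {a : G.E} {x y : G.V}
    (h : G.IsWalkFrom x y (p ++ a :: q)) :
    G.internals (p ++ a :: q) = p.map G.tgt ++ q.map G.src := by
  rw [internals, List.map_append, List.map_cons, List.dropLast_append_of_ne_nil (by simp),
    h.of_append.2.dropLast_vertices]

/-- The vertex before the edge at position `k` of a walk. -/
theorem IsWalkFrom.src_getElem :
    ∀ {es : List G.E} {u v : G.V}, G.IsWalkFrom u v es → ∀ (k : ℕ) (hk : k < es.length),
      G.src es[k] = (G.pathVerts u es)[k]'(by simp [pathVerts]; omega)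
  | [], _, _, _, _, hk => absurd hk (by simp)
  | _ :: _, _, _, h, 0, _ => h.1
  | _ :: _, _, _, h, k + 1, hk => h.2.src_getElem k (by simpa using hk)

theorem IsWalkFrom.getElem_length :
    ∀ {es : List G.E} {u v : G.V}, G.IsWalkFrom u v es →
      (G.pathVerts u es)[es.length]'(by simp [pathVerts]) = v
  | [], _, _, h => h
  | _ :: _, _, _, h => h.2.getElem_length

/-- `y` can be reached from `x` by a directed walk. -/
def Reach (G : MultiDigraph) (x y : G.V) : Prop := ∃ es, G.IsWalkFrom x y es

theorem Reach.refl (x : G.V) : G.Reach x x := ⟨[], rfl⟩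

theorem Reach.trans {x y z : G.V} : G.Reach x y → G.Reach y z → G.Reach x z
  | ⟨_, hp⟩, ⟨_, hq⟩ => ⟨_, hq.append hp⟩

theorem Reach.edge (e : G.E) : G.Reach (G.src e) (G.tgt e) := ⟨[e], rfl, rfl⟩

theorem Reach.transpose {x y : G.V} : G.Reach x y → G.transpose.Reach y x := by
  rintro ⟨es, h⟩
  induction es generalizing x with
  | nil => exact ⟨[], h.symm⟩
  | cons a q ih =>
    obtain ⟨h₁, h₂⟩ := h
    have h_edge : G.transpose.Reach (G.tgt a) (G.src a) := Reach.edge (G := G.transpose) a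
    exact (ih h₂).trans (h₁ ▸ h_edge)

/-- Every vertex lies on a walk from `s` to `t`. -/
def Spans (G : MultiDigraph) (s t : G.V) : Prop := ∀ x, G.Reach s x ∧ G.Reach x t

theorem Spans.transpose {s t : G.V} (h : G.Spans s t) : G.transpose.Spans t s :=
  fun x => ⟨(h x).2.transpose, (h x).1.transpose⟩

end Walks

section Layered

variable {G : MultiDigraph}

/-- `x` is the only vertex at its height, and no edge passes over it. -/
def IsCut (G : MultiDigraph) (r : G.V → ℚ) (x : G.V) : Prop :=
  (∀ y, r y = r x → y = x) ∧ ∀ e, r (G.src e) < r x → r (G.tgt e) ≤ r x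

/-- The height `r` increases along edges, and every vertex at which two edges diverge or
merge is a cut vertex for `r`. -/
structure IsLayering (G : MultiDigraph) (r : G.V → ℚ) : Prop where
  lt : ∀ e, r (G.src e) < r (G.tgt e)
  cut_src : ∀ a b, a ≠ b → G.src a = G.src b → G.IsCut r (G.src a)
  cut_tgt : ∀ a b, a ≠ b → G.tgt a = G.tgt b → G.IsCut r (G.tgt a)

/-- `G` has a layering. -/
def Layered (G : MultiDigraph) : Prop := ∃ r, G.IsLayering r

theorem Layered.comap {K : MultiDigraph} (fv : K.V → G.V) (fe : K.E → G.E)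
    (hv : Function.Injective fv) (he : Function.Injective fe)
    (h_src : ∀ e, G.src (fe e) = fv (K.src e)) (h_tgt : ∀ e, G.tgt (fe e) = fv (K.tgt e)) :
    G.Layered → K.Layered := by
  rintro ⟨r, h⟩
  have h_cut : ∀ x, G.IsCut r (fv x) → K.IsCut (r ∘ fv) x := fun x hx =>
    ⟨fun y hy => hv (hx.1 _ hy), fun e => by simpa [h_src, h_tgt] using hx.2 (fe e)⟩
  refine ⟨r ∘ fv, fun e => by simpa [h_src, h_tgt] using h.lt (fe e), ?_, ?_⟩
  · intro a b hab h_eq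
    exact h_cut _ (h_src a ▸ h.cut_src _ _ (he.ne hab) (by rw [h_src, h_src, h_eq]))
  · intro a b hab h_eq
    exact h_cut _ (h_tgt a ▸ h.cut_tgt _ _ (he.ne hab) (by rw [h_tgt, h_tgt, h_eq]))

theorem Layered.transpose : G.Layered → G.transpose.Layered := by
  rintro ⟨r, h⟩
  have h_cut : ∀ x, G.IsCut r x → G.transpose.IsCut (fun y => -r y) x := by
    refine fun x hx => ⟨fun y hy => hx.1 y (neg_injective hy), fun e he => ?_⟩
    by_contra! h_lt
    have h₁ : r x < r (G.tgt e) := neg_lt_neg_iff.1 he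
    have h₂ : r (G.src e) < r x := neg_lt_neg_iff.1 h_lt
    exact (hx.2 e h₂).not_gt h₁
  exact ⟨fun y => -r y, fun e => neg_lt_neg (h.lt e),
    fun a b hab h_eq => h_cut _ (h.cut_tgt a b hab h_eq),
    fun a b hab h_eq => h_cut _ (h.cut_src a b hab h_eq)⟩

theorem IsChainOfParallelLinks.layered {s t : G.V} (h : G.IsChainOfParallelLinks s t) :
    G.Layered := by
  obtain ⟨m, v, -, -, -, h_inj, h_surj, h_edge, -⟩ := h
  choose i him hi using h_surj
  have hiv : ∀ j, j ≤ m → i (v j) = j := fun j hj => h_inj _ _ (him _) hj (hi _)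
  have h_step : ∀ e, i (G.tgt e) = i (G.src e) + 1 := by
    intro e
    obtain ⟨j, hj, h₁, h₂⟩ := h_edge e
    rw [h₁, h₂, hiv _ (by omega), hiv _ (by omega)]
  have h_cut : ∀ x, G.IsCut (fun x => (i x : ℚ)) x := by
    refine fun x => ⟨fun y hy => ?_, fun e he => ?_⟩
    · rw [← hi x, ← hi y, Nat.cast_injective hy]
    · have h_lt : i (G.src e) < i x := Nat.cast_lt.1 he
      have h_le : i (G.tgt e) ≤ i x := by rw [h_step]; omega
      exact Nat.cast_le.2 h_le
  refine ⟨_, fun e => ?_, fun a _ _ _ => h_cut _, fun a _ _ _ => h_cut _⟩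
  simp [h_step]

theorem IsChainOfParallelLinks.ne {s t : G.V} (h : G.IsChainOfParallelLinks s t) : s ≠ t := by
  obtain ⟨m, v, hm, rfl, rfl, h_inj, -⟩ := h
  intro h_eq
  have := h_inj 0 m (by omega) le_rfl h_eq
  omega

theorem IsChainOfParallelLinks.spans {s t : G.V} (h : G.IsChainOfParallelLinks s t) :
    G.Spans s t := by
  obtain ⟨m, v, hm, rfl, rfl, -, h_surj, -, h_edge⟩ := h
  have h_reach : ∀ i d, i + d ≤ m → G.Reach (v i) (v (i + d)) := by
    intro i d
    induction d with
    | zero => exact fun _ => Reach.refl _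
    | succ d ih =>
      intro hd
      obtain ⟨e, h₁, h₂⟩ := h_edge (i + d) (by omega)
      have h_edge := Reach.edge e
      rw [h₁, h₂] at h_edge
      exact (ih (by omega)).trans h_edge
  intro x
  obtain ⟨i, hi, rfl⟩ := h_surj x
  refine ⟨by simpa using h_reach 0 i (by omega), ?_⟩
  simpa [Nat.add_sub_cancel' hi] using h_reach i (m - i) (by omega)

end Layered

section Subdivision

variable {G H : MultiDigraph}

theorem getElem_mem_internals {es : List G.E} {k : ℕ} (hk : k + 1 < es.length) :
    G.tgt (es[k]'(by omega)) ∈ G.internals es :=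
  List.mem_iff_getElem.2 ⟨k, by simp [internals]; omega, by simp [internals]⟩

theorem exists_of_mem_internals {es : List G.E} {x : G.V} (hx : x ∈ G.internals es) :
    ∃ (k : ℕ) (hk : k + 1 < es.length), G.tgt (es[k]'(by omega)) = x := by
  obtain ⟨k, hk, h⟩ := List.mem_iff_getElem.1 hx
  simp only [internals, List.length_dropLast, List.length_map] at hk
  exact ⟨k, by omega, by simpa [internals] using h⟩

theorem reach_of_subdivision {φ : H.V → G.V} {P : H.E → List G.E}
    (h_path : ∀ e, G.IsPathFrom (φ (H.src e)) (φ (H.tgt e)) (P e) ∧ P e ≠ []) {x y : H.V} :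
    H.Reach x y → G.Reach (φ x) (φ y) := by
  rintro ⟨es, h⟩
  induction es generalizing x with
  | nil => exact ⟨[], congrArg φ h⟩
  | cons a q ih =>
    obtain ⟨rfl, h₂⟩ := h
    exact Reach.trans ⟨_, (h_path a).1.1⟩ (ih h₂)

theorem Spans.of_subdivision {φ : H.V → G.V} (h_sub : IsSubdivisionWith G H φ) {s t : H.V}
    (h : H.Spans s t) : G.Spans (φ s) (φ t) := by
  obtain ⟨P, -, h_path, -, -, -, -, h_vert⟩ := h_sub
  have h_reach {x y : H.V} : H.Reach x y → G.Reach (φ x) (φ y) := reach_of_subdivision h_path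
  intro x
  obtain ⟨y, rfl⟩ | ⟨e, hx⟩ := h_vert x
  · exact ⟨h_reach (h y).1, h_reach (h y).2⟩
  · obtain ⟨a, ha, rfl⟩ := List.mem_map.1 (List.mem_of_mem_dropLast hx)
    obtain ⟨p, q, hpq⟩ := List.append_of_mem ha
    have h_walk := (h_path e).1.1
    rw [hpq] at h_walk
    exact ⟨(h_reach (h _).1).trans ⟨_, h_walk.of_append.1.snoc⟩,
      Reach.trans ⟨_, h_walk.of_append.2⟩ (h_reach (h _).2)⟩

theorem Layered.of_subdivision {φ : H.V → G.V} (h_sub : IsSubdivisionWith G H φ) :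
    H.Layered → G.Layered := by
  rintro ⟨r, hr⟩
  obtain ⟨P, h_inj, h_path, h_int, h_disj, -, h_edge, h_vert⟩ := h_sub
  have h_pos : ∀ e, 0 < (P e).length := fun e => List.length_pos_iff.2 (h_path e).2
  -- consecutive edges of the subdivided edges
  have h_first : ∀ e, G.src ((P e)[0]'(h_pos e)) = φ (H.src e) := fun e =>
    (h_path e).1.1.src_getElem 0 (h_pos e)
  have h_next : ∀ e k (hk : k + 1 < (P e).length),
      G.src (P e)[k + 1] = G.tgt (P e)[k] := fun e k hk => by
    rw [(h_path e).1.1.src_getElem (k + 1) hk]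
    simp [pathVerts]
  have h_last : ∀ e k (hk : k < (P e).length), k + 1 = (P e).length →
      G.tgt (P e)[k] = φ (H.tgt e) := fun e k hk h_eq => by
    rw [← (h_path e).1.1.getElem_length]
    simp [pathVerts, ← h_eq]
  have h_index : ∀ e k l (hk : k < (P e).length) (hl : l < (P e).length),
      G.tgt (P e)[k] = G.tgt (P e)[l] → k = l := fun e k l hk hl h_eq => by
    have h_nodup := (List.nodup_cons.1 (h_path e).1.2).2
    exact (h_nodup.getElem_inj_iff (hi := by simpa) (hj := by simpa)).1 (by simpa using h_eq)
  -- the interpolated height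
  let val : H.E → ℕ → ℚ := fun e k =>
    r (H.src e) + (r (H.tgt e) - r (H.src e)) * (k / (P e).length)
  have h_val_zero : ∀ e, val e 0 = r (H.src e) := fun e => by simp [val]
  have h_val_last : ∀ e, val e (P e).length = r (H.tgt e) := fun e => by
    have : ((P e).length : ℚ) ≠ 0 := by exact_mod_cast (h_pos e).ne'
    simp [val, this]
  have h_val_mono : ∀ e, StrictMono (val e) := fun e k l hkl => by
    have h₁ : (0 : ℚ) < (P e).length := by exact_mod_cast h_pos e
    have h₂ : (0 : ℚ) < r (H.tgt e) - r (H.src e) := sub_pos.2 (hr.lt e)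
    have h₃ : (k : ℚ) < l := by exact_mod_cast hkl
    simp only [val]
    gcongr
  obtain ⟨ρ, hρ, hρ_int⟩ : ∃ ρ : G.V → ℚ, (∀ y, ρ (φ y) = r y) ∧
      ∀ e k (hk : k + 1 < (P e).length), ρ (G.tgt (P e)[k]) = val e (k + 1) := by
    have h_total : ∀ x, ∃ c, (∀ y, φ y = x → c = r y) ∧
        ∀ e k (hk : k + 1 < (P e).length), G.tgt (P e)[k] = x → c = val e (k + 1) := by
      intro x
      obtain ⟨y, rfl⟩ | ⟨e, hx⟩ := h_vert x
      · refine ⟨r y, fun z hz => by rw [h_inj hz], fun e k hk hx => ?_⟩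
        exact absurd ⟨y, hx.symm⟩ (h_int e _ (getElem_mem_internals hk))
      · obtain ⟨k, hk, rfl⟩ := exists_of_mem_internals hx
        refine ⟨val e (k + 1), fun y hy => absurd ⟨y, hy⟩ (h_int e _ hx), fun f l hl h_eq => ?_⟩
        obtain rfl : e = f := by
          by_contra h_ne
          exact h_disj e f h_ne _ hx (h_eq ▸ getElem_mem_internals hl)
        rw [h_index e l k (by omega) (by omega) h_eq]
    choose ρ h₁ h₂ using h_total
    exact ⟨ρ, fun y => h₁ _ y rfl, fun e k hk => h₂ _ e k hk rfl⟩
  have h_tgt : ∀ e k (hk : k < (P e).length), ρ (G.tgt (P e)[k]) = val e (k + 1) := by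
    intro e k hk
    rcases (show k + 1 ≤ (P e).length from hk).lt_or_eq with h | h
    · exact hρ_int e k h
    · rw [h_last e k hk h, hρ, h, h_val_last]
  have h_src : ∀ e k (hk : k < (P e).length), ρ (G.src (P e)[k]) = val e k := by
    intro e k hk
    cases k with
    | zero => rw [h_first, hρ, h_val_zero]
    | succ k => rw [h_next, h_tgt]
  have h_cut : ∀ y, H.IsCut r y → G.IsCut ρ (φ y) := by
    intro y hy
    have h_no : ∀ e k l, 0 < l → k < (P e).length → val e k < r y → r y < val e l →
        l ≤ (P e).length → False := by
      intro e k l hl hk h₁ h₂ h₃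
      have h₄ := (h_val_mono e).monotone (Nat.zero_le k)
      have h₅ := (h_val_mono e).monotone h₃
      rw [h_val_zero] at h₄
      rw [h_val_last] at h₅
      exact (hy.2 e (h₄.trans_lt h₁)).not_gt (h₂.trans_le h₅)
    refine ⟨fun x hx => ?_, fun a ha => ?_⟩
    · rw [hρ] at hx
      obtain ⟨z, rfl⟩ | ⟨e, hxe⟩ := h_vert x
      · rw [hρ] at hx
        rw [hy.1 z hx]
      · obtain ⟨k, hk, rfl⟩ := exists_of_mem_internals hxe
        rw [hρ_int e k hk] at hx
        exact (h_no e k (k + 2) (by omega) (by omega) (hx ▸ h_val_mono e (by omega))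
          (hx ▸ h_val_mono e (by omega)) hk).elim
    · obtain ⟨e, hae⟩ := h_edge a
      obtain ⟨k, hk, rfl⟩ := List.mem_iff_getElem.1 hae
      rw [hρ] at ha ⊢
      rw [h_src] at ha
      rw [h_tgt]
      by_contra! h_gt
      exact h_no e k (k + 1) (by omega) hk ha h_gt hk
  refine ⟨ρ, fun a => ?_, fun a b hab h_eq => ?_, fun a b hab h_eq => ?_⟩
  · obtain ⟨e, hae⟩ := h_edge a
    obtain ⟨k, hk, rfl⟩ := List.mem_iff_getElem.1 hae
    rw [h_src, h_tgt]
    exact h_val_mono e (by omega)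
  · obtain ⟨e, hae⟩ := h_edge a
    obtain ⟨k, hk, rfl⟩ := List.mem_iff_getElem.1 hae
    obtain ⟨f, hbf⟩ := h_edge b
    obtain ⟨l, hl, rfl⟩ := List.mem_iff_getElem.1 hbf
    have h_ne : e ≠ f := by
      rintro rfl
      have h_ρ := congrArg ρ h_eq
      rw [h_src, h_src] at h_ρ
      obtain rfl := (h_val_mono e).injective h_ρ
      exact hab rfl
    rcases k with _ | k <;> rcases l with _ | l
    · rw [h_first, h_first] at h_eq
      rw [h_first]
      exact h_cut _ (hr.cut_src e f h_ne (h_inj h_eq))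
    · rw [h_first, h_next] at h_eq
      exact absurd ⟨_, h_eq⟩ (h_int f _ (getElem_mem_internals hl))
    · rw [h_first, h_next] at h_eq
      exact absurd ⟨_, h_eq.symm⟩ (h_int e _ (getElem_mem_internals hk))
    · rw [h_next, h_next] at h_eq
      exact absurd (h_eq ▸ getElem_mem_internals hl)
        (h_disj e f h_ne _ (getElem_mem_internals hk))
  · obtain ⟨e, hae⟩ := h_edge a
    obtain ⟨k, hk, rfl⟩ := List.mem_iff_getElem.1 hae
    obtain ⟨f, hbf⟩ := h_edge b
    obtain ⟨l, hl, rfl⟩ := List.mem_iff_getElem.1 hbf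
    have h_ne : e ≠ f := by
      rintro rfl
      obtain rfl := h_index e k l hk hl h_eq
      exact hab rfl
    rcases (show k + 1 ≤ (P e).length from hk).lt_or_eq with hk' | hk' <;>
      rcases (show l + 1 ≤ (P f).length from hl).lt_or_eq with hl' | hl'
    · exact absurd (h_eq ▸ getElem_mem_internals hl')
        (h_disj e f h_ne _ (getElem_mem_internals hk'))
    · rw [h_last f l hl hl'] at h_eq
      exact absurd ⟨_, h_eq.symm⟩ (h_int e _ (getElem_mem_internals hk'))
    · rw [h_last e k hk hk'] at h_eq
      exact absurd ⟨_, h_eq⟩ (h_int f _ (getElem_mem_internals hl'))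
    · rw [h_last e k hk hk', h_last f l hl hl'] at h_eq
      rw [h_last e k hk hk']
      exact h_cut _ (hr.cut_tgt e f h_ne (h_inj h_eq))

end Subdivision

section Segments

variable {G : MultiDigraph} {r : G.V → ℚ}

theorem IsLayering.le_of_walk (hr : G.IsLayering r) :
    ∀ {es : List G.E} {x y : G.V}, G.IsWalkFrom x y es → r x ≤ r y
  | [], _, _, h => (congrArg r h).le
  | e :: _, _, _, h => by
    obtain ⟨rfl, h₂⟩ := h
    exact (hr.lt e).le.trans (hr.le_of_walk h₂)

theorem IsLayering.lt_of_walk (hr : G.IsLayering r) {es : List G.E} (h_ne : es ≠ [])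
    {x y : G.V} (h : G.IsWalkFrom x y es) : r x < r y := by
  cases es with
  | nil => exact absurd rfl h_ne
  | cons a q =>
    obtain ⟨rfl, h₂⟩ := h
    exact (hr.lt a).trans_le (hr.le_of_walk h₂)

theorem IsLayering.isPathFrom (hr : G.IsLayering r) {es : List G.E} {x y : G.V}
    (h : G.IsWalkFrom x y es) : G.IsPathFrom x y es := by
  refine ⟨h, ?_⟩
  induction es generalizing x with
  | nil => simp [pathVerts]
  | cons a q ih =>
    refine List.nodup_cons.2 ⟨fun hx => ?_, ih h.2⟩
    obtain ⟨b, hb, h_tgt⟩ := List.mem_map.1 hx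
    obtain ⟨p, q', hpq⟩ := List.append_of_mem hb
    rw [hpq] at h
    have h_lt := hr.lt_of_walk (by simp) h.of_append.1.snoc
    exact h_lt.ne (congrArg r h_tgt.symm)

theorem IsCut.mem_pathVerts {c : G.V} (hc : G.IsCut r c) :
    ∀ {es : List G.E} {x y : G.V}, G.IsWalkFrom x y es → r x ≤ r c → r c ≤ r y →
      c ∈ G.pathVerts x es
  | [], x, y, h, h₁, h₂ => by
    cases (show x = y from h)
    simp [pathVerts, hc.1 x (h₁.antisymm h₂)]
  | e :: es, x, y, h, h₁, h₂ => by
    rcases h₁.eq_or_lt with h_eq | h_lt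
    · simp [pathVerts, hc.1 x h_eq]
    · obtain ⟨rfl, h'⟩ := h
      exact List.mem_cons_of_mem _ (hc.mem_pathVerts h' (hc.2 e h_lt) h₂)

/-- A nonempty walk between cut vertices without internal cut vertices. -/
def IsSegment (G : MultiDigraph) (r : G.V → ℚ) (u v : G.V) (es : List G.E) : Prop :=
  es ≠ [] ∧ G.IsWalkFrom u v es ∧ G.IsCut r u ∧ G.IsCut r v ∧
    ∀ x ∈ G.internals es, ¬ G.IsCut r x

theorem IsLayering.forward_unique (hr : G.IsLayering r) :
    ∀ {q q' : List G.E} {x v v' : G.V}, G.IsWalkFrom x v q → G.IsWalkFrom x v' q' →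
      G.IsCut r v → G.IsCut r v' → (∀ b ∈ q, ¬ G.IsCut r (G.src b)) →
      (∀ b ∈ q', ¬ G.IsCut r (G.src b)) → q = q'
  | [], [], _, _, _, _, _, _, _, _, _ => rfl
  | [], b :: _, x, v, _, h, h', hv, _, _, hq' => by
    cases (show x = v from h)
    exact absurd (h'.1.symm ▸ hv) (hq' b (by simp))
  | b :: _, [], x, _, v', h, h', _, hv', hq, _ => by
    cases (show x = v' from h')
    exact absurd (h.1.symm ▸ hv') (hq b (by simp))
  | b :: q, b' :: q', x, _, _, h, h', hv, hv', hq, hq' => by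
    obtain rfl : b = b' := by
      by_contra h_ne
      exact hq b (by simp) (hr.cut_src b b' h_ne (h.1.trans h'.1.symm))
    rw [hr.forward_unique h.2 h'.2 hv hv' (fun c hc => hq c (by simp [hc]))
      (fun c hc => hq' c (by simp [hc]))]

theorem IsLayering.backward_unique (hr : G.IsLayering r) {p p' : List G.E} {u u' x : G.V}
    (h : G.IsWalkFrom u x p) (h' : G.IsWalkFrom u' x p') (hu : G.IsCut r u) (hu' : G.IsCut r u')
    (hp : ∀ b ∈ p, ¬ G.IsCut r (G.tgt b)) (hp' : ∀ b ∈ p', ¬ G.IsCut r (G.tgt b)) :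
    p = p' := by
  induction p using List.reverseRecOn generalizing p' x with
  | nil =>
    cases (show u = x from h)
    rcases List.eq_nil_or_concat' p' with rfl | ⟨q, b, rfl⟩
    · rfl
    · have h_tgt : G.tgt b = u := h'.of_append.2
      exact absurd (h_tgt.symm ▸ hu) (hp' b (by simp))
  | append_singleton p a ih =>
    have ha : G.tgt a = x := h.of_append.2
    rcases List.eq_nil_or_concat' p' with rfl | ⟨q, b, rfl⟩
    · cases (show u' = x from h')
      exact absurd (ha.symm ▸ hu') (hp a (by simp))
    · have hb : G.tgt b = x := h'.of_append.2
      obtain rfl : a = b := by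
        by_contra h_ne
        exact hp a (by simp) (hr.cut_tgt a b h_ne (ha.trans hb.symm))
      rw [ih h.of_append.1 h'.of_append.1 (fun c hc => hp c (by simp [hc]))
        (fun c hc => hp' c (by simp [hc]))]

theorem IsSegment.eq_of_mem (hr : G.IsLayering r) {u v u' v' : G.V} {es es' : List G.E}
    (h : G.IsSegment r u v es) (h' : G.IsSegment r u' v' es') {a : G.E} (ha : a ∈ es)
    (ha' : a ∈ es') : es = es' := by
  obtain ⟨p, q, rfl⟩ := List.append_of_mem ha
  obtain ⟨p', q', rfl⟩ := List.append_of_mem ha'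
  obtain ⟨-, hw, hu, hv, h_int⟩ := h
  obtain ⟨-, hw', hu', hv', h_int'⟩ := h'
  rw [hw.internals_append] at h_int
  rw [hw'.internals_append] at h_int'
  simp only [List.mem_append, List.mem_map] at h_int h_int'
  rw [hr.forward_unique hw.of_append.2 hw'.of_append.2 hv hv'
      (fun b hb => h_int _ (Or.inr ⟨b, hb, rfl⟩)) (fun b hb => h_int' _ (Or.inr ⟨b, hb, rfl⟩)),
    hr.backward_unique hw.of_append.1 hw'.of_append.1 hu hu'
      (fun b hb => h_int _ (Or.inl ⟨b, hb, rfl⟩)) (fun b hb => h_int' _ (Or.inl ⟨b, hb, rfl⟩))]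

theorem exists_forward_walk :
    ∀ {q : List G.E} {x t : G.V}, G.IsWalkFrom x t q → G.IsCut r t →
      ∃ v q', G.IsWalkFrom x v q' ∧ G.IsCut r v ∧ ∀ b ∈ q', ¬ G.IsCut r (G.src b)
  | [], x, t, h, ht => ⟨t, [], h, ht, by simp⟩
  | b :: q, x, t, h, ht => by
    by_cases hx : G.IsCut r x
    · exact ⟨x, [], rfl, hx, by simp⟩
    · obtain ⟨v, q', hw, hv, hq'⟩ := exists_forward_walk h.2 ht
      refine ⟨v, b :: q', ⟨h.1, hw⟩, hv, ?_⟩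
      simpa [h.1, hx] using hq'

theorem exists_backward_walk {p : List G.E} {s x : G.V} (h : G.IsWalkFrom s x p)
    (hs : G.IsCut r s) :
    ∃ u p', G.IsWalkFrom u x p' ∧ G.IsCut r u ∧ ∀ b ∈ p', ¬ G.IsCut r (G.tgt b) := by
  induction p using List.reverseRecOn generalizing x with
  | nil => exact ⟨s, [], h, hs, by simp⟩
  | append_singleton p a ih =>
    obtain rfl : G.tgt a = x := h.of_append.2
    by_cases hx : G.IsCut r (G.tgt a)
    · exact ⟨_, [], rfl, hx, by simp⟩
    · obtain ⟨u, p', hw, hu, hp'⟩ := ih h.of_append.1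
      refine ⟨u, p' ++ [a], hw.snoc, hu, ?_⟩
      intro b hb
      rcases List.mem_append.1 hb with hb | hb
      · exact hp' b hb
      · rwa [List.mem_singleton.1 hb]

theorem exists_segment {s t : G.V} (h_spans : G.Spans s t) (hs : G.IsCut r s)
    (ht : G.IsCut r t) (a : G.E) : ∃ u v es, G.IsSegment r u v es ∧ a ∈ es := by
  obtain ⟨p₀, hp₀⟩ := (h_spans (G.src a)).1
  obtain ⟨q₀, hq₀⟩ := (h_spans (G.tgt a)).2
  obtain ⟨u, p, hp, hu, hp_cut⟩ := exists_backward_walk hp₀ hs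
  obtain ⟨v, q, hq, hv, hq_cut⟩ := exists_forward_walk hq₀ ht
  have h_walk : G.IsWalkFrom u v (p ++ a :: q) :=
    IsWalkFrom.append (q := a :: q) ⟨rfl, hq⟩ hp
  refine ⟨u, v, p ++ a :: q, ⟨by simp, h_walk, hu, hv, fun x hx => ?_⟩, by simp⟩
  rw [h_walk.internals_append, List.mem_append, List.mem_map, List.mem_map] at hx
  rcases hx with ⟨b, hb, rfl⟩ | ⟨b, hb, rfl⟩
  · exact hp_cut b hb
  · exact hq_cut b hb

theorem IsSegment.not_between {u v c : G.V} {es : List G.E} (h : G.IsSegment r u v es)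
    (hc : G.IsCut r c) (huc : r u < r c) (hcv : r c < r v) : False := by
  obtain ⟨-, hw, -, -, h_int⟩ := h
  rcases List.mem_cons.1 (hc.mem_pathVerts hw huc.le hcv.le) with rfl | h_mem
  · exact huc.false
  · obtain ⟨a, ha, rfl⟩ := List.mem_map.1 h_mem
    obtain ⟨p, q, rfl⟩ := List.append_of_mem ha
    rw [hw.internals_append] at h_int
    have hq := hw.of_append.2
    cases q with
    | nil => exact hcv.ne (congrArg r hq)
    | cons b q => exact h_int _ (by simp [hq.1]) hc

/-- The graph whose vertices are the cut vertices and whose edges are the segments. -/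
def segmentGraph (G : MultiDigraph) (r : G.V → ℚ) : MultiDigraph where
  V := {x // G.IsCut r x}
  E := {p : {x // G.IsCut r x} × {x // G.IsCut r x} × List G.E //
    G.IsSegment r p.1 p.2.1 p.2.2}
  src e := e.1.1
  tgt e := e.1.2.1

theorem IsLayering.isSubdivisionWith (hr : G.IsLayering r) {s t : G.V} (h_spans : G.Spans s t)
    (hs : G.IsCut r s) (ht : G.IsCut r t) :
    IsSubdivisionWith G (G.segmentGraph r) Subtype.val := by
  have h_eq : ∀ (e f : (G.segmentGraph r).E) (a : G.E), a ∈ e.1.2.2 → a ∈ f.1.2.2 → e = f := by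
    intro e f a ha hb
    have h_list := e.2.eq_of_mem hr f.2 ha hb
    have hf := f.2.2.1
    rw [← h_list] at hf
    obtain ⟨h₁, h₂⟩ := IsWalkFrom.endpoints_unique e.2.1 e.2.2.1 hf
    exact Subtype.ext (Prod.ext (Subtype.ext h₁) (Prod.ext (Subtype.ext h₂) h_list))
  refine ⟨fun e => e.1.2.2, Subtype.val_injective,
    fun e => ⟨hr.isPathFrom e.2.2.1, e.2.1⟩, ?_, ?_, ?_, ?_, ?_⟩
  · rintro e x hx ⟨y, rfl⟩
    exact e.2.2.2.2.2 _ hx y.2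
  · intro e f h_ne x hx hx'
    obtain ⟨a, ha, rfl⟩ := List.mem_map.1 (List.mem_of_mem_dropLast hx)
    obtain ⟨b, hb, h_tgt⟩ := List.mem_map.1 (List.mem_of_mem_dropLast hx')
    obtain rfl : a = b := by
      by_contra h_ab
      exact e.2.2.2.2.2 _ hx (hr.cut_tgt a b h_ab h_tgt.symm)
    exact h_ne (h_eq e f a ha hb)
  · exact fun e f h_ne a ha hb => h_ne (h_eq e f a ha hb)
  · intro a
    obtain ⟨u, v, es, h, ha⟩ := exists_segment h_spans hs ht a
    exact ⟨⟨(⟨u, h.2.2.1⟩, ⟨v, h.2.2.2.1⟩, es), h⟩, ha⟩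
  · intro x
    by_cases hx : G.IsCut r x
    · exact Or.inl ⟨⟨x, hx⟩, rfl⟩
    right
    obtain ⟨p, hp⟩ := (h_spans x).2
    cases p with
    | nil =>
      cases (show x = t from hp)
      exact absurd ht hx
    | cons a p =>
      obtain ⟨rfl, -⟩ := hp
      obtain ⟨u, v, es, h, ha⟩ := exists_segment h_spans hs ht a
      refine ⟨⟨(⟨u, h.2.2.1⟩, ⟨v, h.2.2.2.1⟩, es), h⟩, ?_⟩
      obtain ⟨q, q', rfl⟩ := List.append_of_mem ha
      have hw := h.2.1
      show G.src a ∈ G.internals (q ++ a :: q')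
      rw [hw.internals_append]
      rcases List.eq_nil_or_concat' q with rfl | ⟨q, b, rfl⟩
      · exact absurd (hw.1 ▸ h.2.2.1) hx
      · have h_tgt : G.tgt b = G.src a := hw.of_append.1.of_append.2
        simp [← h_tgt]

theorem IsLayering.isChainOfParallelLinks (hr : G.IsLayering r) {s t : G.V}
    (h_spans : G.Spans s t) (h_ne : s ≠ t) (hs : G.IsCut r s) (ht : G.IsCut r t) :
    (G.segmentGraph r).IsChainOfParallelLinks ⟨s, hs⟩ ⟨t, ht⟩ := by
  classical
  have hs_le : ∀ x, r s ≤ r x := fun x => (h_spans x).1.elim fun _ h => hr.le_of_walk h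
  have ht_le : ∀ x, r x ≤ r t := fun x => (h_spans x).2.elim fun _ h => hr.le_of_walk h
  have h_fin : {x | G.IsCut r x}.Finite := by
    obtain ⟨p, hp⟩ := (h_spans t).1
    exact (List.finite_toSet (G.pathVerts s p)).subset
      fun c hc => IsCut.mem_pathVerts hc hp (hs_le c) (ht_le c)
  have : Fintype {x // G.IsCut r x} := h_fin.fintype
  let : LinearOrder {x // G.IsCut r x} :=
    LinearOrder.lift' (fun x => r x.1) fun x y h => Subtype.ext (y.2.1 _ h)
  have h_lt_iff : ∀ x y : {x // G.IsCut r x}, x < y ↔ r x.1 < r y.1 := fun _ _ => Iff.rfl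
  have h_le_iff : ∀ x y : {x // G.IsCut r x}, x ≤ y ↔ r x.1 ≤ r y.1 := fun _ _ => Iff.rfl
  have h_card : 1 < Fintype.card {x // G.IsCut r x} :=
    Fintype.one_lt_card_iff.2 ⟨⟨s, hs⟩, ⟨t, ht⟩, fun h => h_ne (congrArg Subtype.val h)⟩
  obtain ⟨m, hm⟩ : ∃ m, Fintype.card {x // G.IsCut r x} = m + 1 :=
    ⟨Fintype.card {x // G.IsCut r x} - 1, by omega⟩
  let f : Fin (m + 1) ≃o {x // G.IsCut r x} := monoEquivOfFin _ hm
  have hf_zero : f 0 = ⟨s, hs⟩ := by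
    refine le_antisymm ?_ ((h_le_iff _ _).2 (hs_le _))
    rw [← f.apply_symm_apply ⟨s, hs⟩]
    exact f.monotone (Fin.zero_le _)
  have hf_last : f (Fin.last m) = ⟨t, ht⟩ := by
    refine le_antisymm ((h_le_iff _ _).2 (ht_le _)) ?_
    rw [← f.apply_symm_apply ⟨t, ht⟩]
    exact f.monotone (Fin.le_last _)
  have h_step : ∀ (e : (G.segmentGraph r).E) (i j : Fin (m + 1)), e.1.1 = f i → e.1.2.1 = f j →
      (j : ℕ) = i + 1 := by
    intro e i j hi hj
    have h_lt : f i < f j := by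
      rw [← hi, ← hj]
      exact (h_lt_iff _ _).2 (hr.lt_of_walk e.2.1 e.2.2.1)
    have hij : (i : ℕ) < j := f.lt_iff_lt.1 h_lt
    by_contra h_gap
    have hk : (i : ℕ) + 1 < m + 1 := by omega
    refine e.2.not_between (f ⟨i + 1, hk⟩).2 ?_ ?_
    · rw [hi]
      refine (h_lt_iff _ _).1 (f.strictMono ?_)
      simp [Fin.lt_def]
    · rw [hj]
      refine (h_lt_iff _ _).1 (f.strictMono ?_)
      rw [Fin.lt_def]
      show (i : ℕ) + 1 < j
      omega
  have hv : ∀ i (hi : i ≤ m), Fin.ofNat (m + 1) i = ⟨i, by omega⟩ := fun i hi =>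
    Fin.ext (Nat.mod_eq_of_lt (by omega))
  refine ⟨m, fun i => f (Fin.ofNat (m + 1) i), by omega, ?_, ?_, ?_, ?_, ?_, ?_⟩
  · exact (congrArg f (hv 0 (by omega))).trans hf_zero
  · exact (congrArg f (hv m le_rfl)).trans hf_last
  · intro i j hi hj h
    have h_eq := f.injective h
    rw [hv i hi, hv j hj] at h_eq
    exact congrArg Fin.val h_eq
  · intro x
    have hx : (f.symm x : ℕ) ≤ m := by omega
    exact ⟨f.symm x, hx, (congrArg f (hv _ hx)).trans (f.apply_symm_apply x)⟩
  · intro e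
    have h := h_step e (f.symm e.1.1) (f.symm e.1.2.1) (by simp) (by simp)
    have h_lt : (f.symm e.1.1 : ℕ) < m := by omega
    exact ⟨f.symm e.1.1, h_lt,
      (f.apply_symm_apply e.1.1).symm.trans (congrArg f (hv _ h_lt.le).symm),
      (f.apply_symm_apply e.1.2.1).symm.trans (congrArg f ((Fin.ext h).trans (hv _ h_lt).symm))⟩
  · intro i hi
    obtain ⟨p, hp⟩ := (h_spans (f ⟨i, by omega⟩).1).2
    cases p with
    | nil =>
      have h_top : f ⟨i, by omega⟩ = f (Fin.last m) := by
        rw [hf_last]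
        exact Subtype.ext hp
      have h_val := congrArg Fin.val (f.injective h_top)
      simp at h_val
      omega
    | cons a p =>
      obtain ⟨u, v, es, h, ha⟩ := exists_segment h_spans hs ht a
      obtain rfl : G.src a = u := by
        obtain ⟨q, q', rfl⟩ := List.append_of_mem ha
        have hw := h.2.1
        rcases List.eq_nil_or_concat' q with rfl | ⟨q, b, rfl⟩
        · exact hw.1
        · have h_int := h.2.2.2.2
          have h_tgt : G.tgt b = G.src a := hw.of_append.1.of_append.2
          rw [hw.internals_append] at h_int
          refine absurd (f ⟨i, by omega⟩).2 (h_int _ ?_)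
          simp [← hp.1, h_tgt]
      let e : (G.segmentGraph r).E := ⟨(⟨G.src a, h.2.2.1⟩, ⟨v, h.2.2.2.1⟩, es), h⟩
      have he : e.1.1 = f ⟨i, by omega⟩ := Subtype.ext hp.1
      have h_idx := h_step e ⟨i, by omega⟩ (f.symm e.1.2.1) he (by simp)
      exact ⟨e, he.trans (congrArg f (hv _ hi.le).symm),
        (f.apply_symm_apply e.1.2.1).symm.trans
          (congrArg f ((Fin.ext h_idx).trans (hv _ hi).symm))⟩

theorem Layered.isChainOfParallelPaths {s t : G.V} (h : G.Layered) (h_spans : G.Spans s t)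
    (h_ne : s ≠ t) : IsChainOfParallelPaths G s t := by
  obtain ⟨r, hr⟩ := h
  have hs_le : ∀ x, r s ≤ r x := fun x => (h_spans x).1.elim fun _ h => hr.le_of_walk h
  have ht_le : ∀ x, r x ≤ r t := fun x => (h_spans x).2.elim fun _ h => hr.le_of_walk h
  have hs : G.IsCut r s := by
    refine ⟨fun y hy => ?_, fun e he => absurd he (hs_le _).not_gt⟩
    obtain ⟨p, hp⟩ := (h_spans y).1
    cases p with
    | nil => exact (show s = y from hp).symm
    | cons a p => exact absurd hy.symm (hr.lt_of_walk (by simp) hp).ne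
  have ht : G.IsCut r t := by
    refine ⟨fun y hy => ?_, fun e _ => ht_le _⟩
    obtain ⟨p, hp⟩ := (h_spans y).2
    cases p with
    | nil => exact hp
    | cons a p => exact absurd hy (hr.lt_of_walk (by simp) hp).ne
  exact ⟨G.segmentGraph r, ⟨s, hs⟩, ⟨t, ht⟩, Subtype.val,
    hr.isChainOfParallelLinks h_spans h_ne hs ht, hr.isSubdivisionWith h_spans hs ht, rfl, rfl⟩

theorem isChainOfParallelPaths_iff {s t : G.V} :
    IsChainOfParallelPaths G s t ↔ G.Layered ∧ G.Spans s t ∧ s ≠ t := by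
  refine ⟨?_, fun h => h.1.isChainOfParallelPaths h.2.1 h.2.2⟩
  rintro ⟨H, s, t, φ, hH, h_sub, rfl, rfl⟩
  exact ⟨hH.layered.of_subdivision h_sub, hH.spans.of_subdivision h_sub,
    h_sub.elim fun _ h => h.1.ne hH.ne⟩

end Segments

section PathUnion

variable {G : MultiDigraph}

theorem reach_pathUnion {u v : G.V} :
    ∀ {es : List G.E} {x y : (G.pathUnion u v).V}, G.IsWalkFrom x.1 y.1 es →
      (∀ e ∈ es, e ∈ G.pathEdges u v) → (G.pathUnion u v).Reach x y
  | [], _, _, h, _ => ⟨[], Subtype.ext h⟩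
  | e :: es, x, y, h, h_mem => by
    let e' : (G.pathUnion u v).E := ⟨e, h_mem e (by simp)⟩
    have hx : (G.pathUnion u v).src e' = x := Subtype.ext h.1
    rw [← hx]
    exact (Reach.edge e').trans
      (reach_pathUnion (es := es) h.2 fun f hf => h_mem f (by simp [hf]))

theorem spans_pathUnion {u v : G.V} (h : ∃ es, G.IsPathFrom u v es) :
    (G.pathUnion u v).Spans ⟨u, G.mem_pathUnion_left u v⟩ ⟨v, G.mem_pathUnion_right u v⟩ := by
  have h_uv : (G.pathUnion u v).Reach ⟨u, G.mem_pathUnion_left u v⟩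
      ⟨v, G.mem_pathUnion_right u v⟩ := by
    obtain ⟨es, hes⟩ := h
    exact reach_pathUnion (es := es) hes.1 fun e he => ⟨es, hes, he⟩
  rintro ⟨x, hx⟩
  rcases id hx with rfl | rfl | ⟨e, ⟨es, hes, he⟩, h_end⟩
  · exact ⟨Reach.refl _, h_uv⟩
  · exact ⟨h_uv, Reach.refl _⟩
  · have h_mem : ∀ f ∈ es, f ∈ G.pathEdges u v := fun f hf => ⟨es, hes, hf⟩
    obtain ⟨p, q, rfl⟩ := List.append_of_mem he
    obtain ⟨hp, hq⟩ := hes.1.of_append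
    rcases h_end with rfl | rfl
    · exact ⟨reach_pathUnion (es := p) hp fun f hf => h_mem f (by simp [hf]),
        reach_pathUnion (es := e :: q) ⟨rfl, hq⟩ fun f hf => h_mem f (by
          simpa using Or.inr (List.mem_cons.1 hf))⟩
    · exact ⟨reach_pathUnion (es := p ++ [e]) hp.snoc fun f hf => h_mem f (by
          simp only [List.mem_append, List.mem_singleton] at hf
          rcases hf with hf | hf <;> simp [hf]),
        reach_pathUnion (es := q) hq fun f hf => h_mem f (by simp [hf])⟩

theorem isChainOfParallelPaths_pathUnion {u v : G.V} {es : List G.E} (h : G.IsPathFrom u v es)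
    (h_ne : es ≠ []) (h_lay : (G.pathUnion u v).Layered) :
    IsChainOfParallelPaths (G.pathUnion u v)
      ⟨u, G.mem_pathUnion_left u v⟩ ⟨v, G.mem_pathUnion_right u v⟩ :=
  h_lay.isChainOfParallelPaths (spans_pathUnion ⟨es, h⟩)
    fun h_eq => h.ne h_ne (congrArg Subtype.val h_eq)

theorem Layered.usesOnlyChains (h : G.Layered) : UsesOnlyChains G := by
  intro u v
  by_cases h_path : ∃ es, G.IsPathFrom u v es ∧ es ≠ []
  · obtain ⟨es, hes, h_ne⟩ := h_path
    exact Or.inr (isChainOfParallelPaths_pathUnion hes h_ne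
      (h.comap Subtype.val Subtype.val Subtype.val_injective Subtype.val_injective
        (fun _ => rfl) fun _ => rfl))
  · exact Or.inl h_path

theorem Layered.edgeSubgraph (h : G.Layered) (S : Set G.E) : (G.edgeSubgraph S).Layered :=
  Layered.comap (G := G) (K := G.edgeSubgraph S) id Subtype.val
    Function.injective_id Subtype.val_injective
    (fun _ => rfl) (fun _ => rfl) h

theorem isWalkFrom_of_edgeSubgraph {S : Set G.E} :
    ∀ {es : List (G.edgeSubgraph S).E} {u v : G.V}, (G.edgeSubgraph S).IsWalkFrom u v es →
      G.IsWalkFrom u v (es.map Subtype.val)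
  | [], _, _, h => h
  | _ :: _, _, _, h => ⟨h.1, isWalkFrom_of_edgeSubgraph h.2⟩

theorem isPathFrom_of_edgeSubgraph {S : Set G.E} {es : List (G.edgeSubgraph S).E} {u v : G.V}
    (h : (G.edgeSubgraph S).IsPathFrom u v es) : G.IsPathFrom u v (es.map Subtype.val) := by
  refine ⟨isWalkFrom_of_edgeSubgraph h.1, ?_⟩
  have h_map : (es.map Subtype.val).map G.tgt = es.map (G.edgeSubgraph S).tgt := List.map_map
  rw [pathVerts, h_map]
  exact h.2

theorem mem_pathEdges_of_edgeSubgraph {S : Set G.E} {u v : G.V} {e : (G.edgeSubgraph S).E} :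
    e ∈ (G.edgeSubgraph S).pathEdges u v → e.1 ∈ G.pathEdges u v
  | ⟨_, hes, he⟩ => ⟨_, isPathFrom_of_edgeSubgraph hes, List.mem_map_of_mem he⟩

theorem UsesOnlyChains.edgeSubgraph (h : UsesOnlyChains G) (S : Set G.E) :
    UsesOnlyChains (G.edgeSubgraph S) := by
  intro u v
  by_cases h_path : ∃ es, (G.edgeSubgraph S).IsPathFrom u v es ∧ es ≠ []
  · obtain ⟨es, hes, h_ne⟩ := h_path
    refine Or.inr (isChainOfParallelPaths_pathUnion hes h_ne ?_)
    rcases h u v with h_no | h_chain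
    · exact absurd ⟨_, isPathFrom_of_edgeSubgraph hes, mt List.map_eq_nil_iff.1 h_ne⟩ h_no
    · refine Layered.comap (G := G.pathUnion u v)
        (K := (G.edgeSubgraph S).pathUnion u v)
        (fun x => ⟨x.1, x.2.imp_right (Or.imp_right fun ⟨e, he, hx⟩ =>
          ⟨e.1, mem_pathEdges_of_edgeSubgraph he, hx⟩)⟩)
        (fun e => ⟨e.1.1, mem_pathEdges_of_edgeSubgraph e.2⟩) ?_ ?_ ?_ ?_
        (isChainOfParallelPaths_iff.1 h_chain).1
      · exact fun x y hxy => Subtype.ext (Subtype.mk.inj hxy)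
      · exact fun x y hxy => Subtype.ext (Subtype.ext (Subtype.mk.inj hxy))
      · exact fun _ => rfl
      · exact fun _ => rfl
  · exact Or.inl h_path

end PathUnion

end MultiDigraph

/-- Closure properties of chains of parallel paths: if `G` is a chain of parallel
paths from `s` to `t`, then every edge-subgraph of `G` uses only chains of parallel
paths, the transpose of `G` is a chain of parallel paths from `t` to `s`, and every
subdivision of `G` is again a chain of parallel paths (between the corresponding
vertices). In particular, the class of graphs using only chains of parallel paths
is closed under taking subgraphs. -/
theorem stmt12 :
    (∀ (G : MultiDigraph) (s t : G.V), IsChainOfParallelPaths G s t →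
      (∀ S : Set G.E, UsesOnlyChains (G.edgeSubgraph S)) ∧
      IsChainOfParallelPaths G.transpose t s ∧
      (∀ (G' : MultiDigraph) (φ : G.V → G'.V),
        IsSubdivisionWith G' G φ → IsChainOfParallelPaths G' (φ s) (φ t))) ∧
    (∀ G : MultiDigraph, UsesOnlyChains G →
      ∀ S : Set G.E, UsesOnlyChains (G.edgeSubgraph S)) := by
  refine ⟨fun G s t h => ?_, fun G h S => MultiDigraph.UsesOnlyChains.edgeSubgraph h S⟩
  obtain ⟨h_lay, h_spans, h_ne⟩ := isChainOfParallelPaths_iff.1 h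
  exact ⟨fun S => (h_lay.edgeSubgraph S).usesOnlyChains,
    h_lay.transpose.isChainOfParallelPaths h_spans.transpose h_ne.symm,
    fun G' φ h_sub => (h_lay.of_subdivision h_sub).isChainOfParallelPaths
      (h_spans.of_subdivision h_sub) (h_sub.elim fun _ h => h.1.ne h_ne)⟩
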